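/- arXiv:2512.04417 — 3 statements merged into one kernel-verified Lean document; each statement's English description precedes it below -/
import Mathlib

section
/- For every integer m ≥ 1, the number (m+1)(m²+m+1) is {0, m}-perfect; indeed (m+1)(m²+m+1) = 1 + m·(m+1) + m·(m²+m+1), where m+1 and m²+m+1 are proper divisors of (m+1)(m²+m+1) strictly between 1 and (m+1)(m²+m+1). -/
/-- The positive divisors of `n` strictly between `1` and `|n|`,
i.e. the divisors `d_1 < ⋯ < d_k` in `1 = d_0 < d_1 < ⋯ < d_k < d_{k+1} = |n|`. -/
def midDivisors (n : ℤ) : Finset ℕ :=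
  n.natAbs.divisors.filter (fun d => 1 < d ∧ d < n.natAbs)

/-- An integer `n` with `|n| > 1` is `S`-perfect (of the first kind) if
`n = 1 + ∑_{j=1}^k λ_j d_j` for some coefficients `λ_j ∈ S`. -/
def IsSPerfect (S : Set ℤ) (n : ℤ) : Prop :=
  1 < n.natAbs ∧ ∃ lam : ℕ → ℤ,
    (∀ d ∈ midDivisors n, lam d ∈ S) ∧
    n = 1 + ∑ d ∈ midDivisors n, lam d * (d : ℤ)

theorem mem_midDivisors {n : ℤ} {d : ℕ} :
    d ∈ midDivisors n ↔ (d : ℤ) ∣ n ∧ 1 < d ∧ d < n.natAbs := by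
  rw [midDivisors, Finset.mem_filter, Nat.mem_divisors, Int.natCast_dvd]
  exact ⟨fun h => ⟨h.1.1, h.2⟩, fun h => ⟨⟨h.1, by omega⟩, h.2⟩⟩

/-- If `n` is one more than `m` times a sum of distinct divisors of `n` strictly between `1` and
`|n|`, then `n` is `{0, m}`-perfect. -/
theorem isSPerfect_of_subset_midDivisors {n m : ℤ} (hn : 1 < n.natAbs) {T : Finset ℕ}
    (hT : T ⊆ midDivisors n) (h : n = 1 + ∑ d ∈ T, m * (d : ℤ)) : IsSPerfect {0, m} n := by
  refine ⟨hn, fun d => if d ∈ T then m else 0, fun d _ => ?_, ?_⟩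
  · by_cases hd : d ∈ T <;> simp [hd]
  · simpa only [ite_mul, zero_mul, Finset.sum_ite_mem, Finset.inter_eq_right.mpr hT] using h

theorem stmt6 (m : ℤ) (hm : 1 ≤ m) :
    IsSPerfect {0, m} ((m + 1) * (m ^ 2 + m + 1)) ∧
    (m + 1) * (m ^ 2 + m + 1) = 1 + m * (m + 1) + m * (m ^ 2 + m + 1) ∧
    (m + 1) ∣ (m + 1) * (m ^ 2 + m + 1) ∧
    1 < m + 1 ∧ m + 1 < (m + 1) * (m ^ 2 + m + 1) ∧
    (m ^ 2 + m + 1) ∣ (m + 1) * (m ^ 2 + m + 1) ∧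
    1 < m ^ 2 + m + 1 ∧ m ^ 2 + m + 1 < (m + 1) * (m ^ 2 + m + 1) := by
  have identity : (m + 1) * (m ^ 2 + m + 1) = 1 + m * (m + 1) + m * (m ^ 2 + m + 1) := by ring
  have one_lt_left : 1 < m + 1 := by linarith
  have one_lt_right : 1 < m ^ 2 + m + 1 := by nlinarith
  have left_lt : m + 1 < (m + 1) * (m ^ 2 + m + 1) := by nlinarith
  have right_lt : m ^ 2 + m + 1 < (m + 1) * (m ^ 2 + m + 1) := by nlinarith
  have left_ne_right : (m + 1).toNat ≠ (m ^ 2 + m + 1).toNat := by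
    have : m + 1 < m ^ 2 + m + 1 := by nlinarith
    omega
  refine ⟨isSPerfect_of_subset_midDivisors (T := {(m + 1).toNat, (m ^ 2 + m + 1).toNat})
    (by omega) ?_ ?_, identity, dvd_mul_right _ _, one_lt_left, left_lt, dvd_mul_left _ _,
    one_lt_right, right_lt⟩
  · simp only [Finset.insert_subset_iff, Finset.singleton_subset_iff, mem_midDivisors]
    rw [Int.toNat_of_nonneg (by linarith), Int.toNat_of_nonneg (by linarith)]
    exact ⟨⟨dvd_mul_right _ _, by omega, by omega⟩, dvd_mul_left _ _, by omega, by omega⟩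
  · rw [Finset.sum_pair left_ne_right, Int.toNat_of_nonneg (by linarith),
      Int.toNat_of_nonneg (by linarith)]
    linarith
end

section
/- For every integer m ≥ 1, there exist infinitely many positive {−1, m}-perfect numbers. -/
theorem isSPerfect_of_sum_divisors {m : ℤ} {n : ℕ} (hn : 1 < n) {A : Finset ℕ}
    (hA : ∀ d ∈ A, d ∣ n ∧ 1 < d ∧ d < n)
    (h : ((∑ d ∈ n.divisors, d : ℕ) : ℤ) = 2 + (m + 1) * ((∑ d ∈ A, d : ℕ) : ℤ)) :
    IsSPerfect {-1, m} n := by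
  refine ⟨by simpa using hn, fun d => if d ∈ A then m else -1, ?_, ?_⟩
  · intro d _
    by_cases hd : d ∈ A <;> simp [hd]
  · have hmid : n.divisors = insert 1 (insert n (midDivisors n)) := by
      ext d
      simp only [Nat.mem_divisors, midDivisors, Int.natAbs_natCast, Finset.mem_insert,
        Finset.mem_filter]
      constructor
      · rintro ⟨hd, h0⟩
        have := Nat.le_of_dvd (by omega) hd
        have := Nat.pos_of_dvd_of_pos hd (by omega)
        by_cases h1 : d = 1
        · exact Or.inl h1
        by_cases h2 : d = n
        · exact Or.inr (Or.inl h2)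
        exact Or.inr (Or.inr ⟨⟨hd, h0⟩, by omega, by omega⟩)
      · rintro (rfl | rfl | h)
        · exact ⟨one_dvd _, by omega⟩
        · exact ⟨dvd_rfl, by omega⟩
        · exact h.1
    have hsub : A ⊆ midDivisors n := by
      intro d hd
      simp only [midDivisors, Int.natAbs_natCast, Finset.mem_filter, Nat.mem_divisors]
      exact ⟨⟨(hA d hd).1, by omega⟩, (hA d hd).2⟩
    have hlam : ∀ d : ℕ, (if d ∈ A then m else -1) * (d : ℤ)
        = (if d ∈ A then (m + 1) * (d : ℤ) else 0) - d := by
      intro d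
      split_ifs <;> ring
    rw [hmid, Finset.sum_insert, Finset.sum_insert] at h
    · simp only [hlam]
      rw [Finset.sum_sub_distrib, Finset.sum_ite_mem, Finset.inter_eq_right.2 hsub,
        ← Finset.mul_sum]
      push_cast at h
      linarith
    · simp [midDivisors]
    · simp only [midDivisors, Finset.mem_insert, Finset.mem_filter]
      omega

theorem exists_subset_range_sum_two_pow (k x : ℕ) (hx : x < 2 ^ k) :
    ∃ A ⊆ Finset.range k, ∑ i ∈ A, 2 ^ i = x := by
  refine ⟨x.bitIndices.toFinset, ?_, ?_⟩
  · intro i hi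
    have := Nat.two_pow_le_of_mem_bitIndices (List.mem_toFinset.1 hi)
    exact Finset.mem_range.2 ((Nat.pow_lt_pow_iff_right (by norm_num)).1 (this.trans_lt hx))
  · exact Finset.sum_toFinset_bitIndices_two_pow x

theorem exists_sum_divisors_two_pow_mul_prime {k p x y : ℕ} (hp : p.Prime) (hp2 : 2 < p)
    (hx : x < 2 ^ k) (hy : y < 2 ^ k) :
    ∃ A : Finset ℕ, (∀ d ∈ A, d ∣ 2 ^ k * p ∧ 1 < d ∧ d < 2 ^ k * p) ∧
      ∑ d ∈ A, d = p * x + 2 * y := by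
  obtain ⟨B, hB, hBx⟩ := exists_subset_range_sum_two_pow k x hx
  obtain ⟨C, hC, hCy⟩ := exists_subset_range_sum_two_pow k y hy
  have hodd : ¬ p ∣ 2 := fun h => by have := Nat.le_of_dvd (by norm_num) h; omega
  refine ⟨B.image (fun i => p * 2 ^ i) ∪ C.image (fun i => 2 * 2 ^ i), ?_, ?_⟩
  · intro d hd
    rcases Finset.mem_union.1 hd with hd | hd <;>
      obtain ⟨i, hi, rfl⟩ := Finset.mem_image.1 hd
    · have hik := Finset.mem_range.1 (hB hi)
      have h1 : 2 ^ i < 2 ^ k := Nat.pow_lt_pow_right (by norm_num) hik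
      have h2 : 0 < 2 ^ i := by positivity
      refine ⟨?_, by nlinarith, by nlinarith⟩
      rw [mul_comm]
      exact mul_dvd_mul_right (pow_dvd_pow 2 hik.le) p
    · have hik := Finset.mem_range.1 (hC hi)
      have h1 : 2 * 2 ^ i ∣ 2 ^ k := by
        rw [← pow_succ']
        exact pow_dvd_pow 2 hik
      have h2 : 0 < 2 ^ i := by positivity
      have h3 := Nat.le_of_dvd (by positivity) h1
      exact ⟨h1.mul_right p, by omega, by nlinarith⟩
  · rw [Finset.sum_union, Finset.sum_image, Finset.sum_image, ← Finset.mul_sum, ← Finset.mul_sum,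
      hBx, hCy]
    · intro i _ j _ hij
      exact Nat.pow_right_injective le_rfl (Nat.eq_of_mul_eq_mul_left (by norm_num) hij)
    · intro i _ j _ hij
      exact Nat.pow_right_injective le_rfl (Nat.eq_of_mul_eq_mul_left hp.pos hij)
    · rw [Finset.disjoint_left]
      rintro _ hi hj
      obtain ⟨i, _, rfl⟩ := Finset.mem_image.1 hi
      obtain ⟨j, _, hij⟩ := Finset.mem_image.1 hj
      have h : p ∣ 2 ^ (j + 1) := ⟨2 ^ i, by rw [pow_succ']; exact hij⟩
      exact hodd (hp.dvd_of_dvd_pow h)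

theorem sum_divisors_two_pow_mul_prime {k p : ℕ} (hp : p.Prime) (hp2 : 2 < p) :
    ∑ d ∈ (2 ^ k * p).divisors, d = (2 ^ (k + 1) - 1) * (p + 1) := by
  have hcop : Nat.Coprime (2 ^ k) p :=
    Nat.Coprime.pow_left k ((Nat.coprime_primes Nat.prime_two hp).2 hp2.ne)
  rw [hcop.sum_divisors_mul, hp.sum_divisors, Nat.sum_divisors_prime_pow Nat.prime_two,
    Nat.geomSum_eq le_rfl]
  simp

/-- Sums `p * x + 2 * y` with `x, y < K` represent `(σ - 2) / M` for `σ = (2 * K - 1) * (p + 1)`. -/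
theorem exists_eq_mul_add_two_mul {K M p T : ℕ} (hM : 2 ≤ M) (hp : p % 2 = 1) (hMp : M < p)
    (hK : 2 * p ≤ K) (hT : (2 * K - 1) * (p + 1) = 2 + M * T) :
    ∃ x < K, ∃ y < K, T = p * x + 2 * y := by
  obtain ⟨r, rfl⟩ : ∃ r, p = 2 * r + 1 := ⟨p / 2, by omega⟩
  obtain ⟨L, rfl⟩ : ∃ L, K = L + 1 := ⟨K - 1, by omega⟩
  have e : 2 * (L + 1) - 1 = 2 * L + 1 := by omega
  rw [e] at hT
  have hlow : 2 * L ≤ T := by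
    by_contra! h
    nlinarith
  have hupp : 2 * T ≤ (2 * L + 1) * (2 * r + 1 + 1) - 2 := by
    have := Nat.mul_le_mul_right T hM
    omega
  obtain ⟨U, rfl⟩ := Nat.exists_eq_add_of_le hlow
  obtain ⟨j, hj, x, hx⟩ : ∃ j < 2 * r + 1, 2 * r + 1 ∣ U + 2 * j := by
    refine ⟨(U * r) % (2 * r + 1), Nat.mod_lt _ (by omega), ?_⟩
    have h1 : U + 2 * ((U * r) % (2 * r + 1)) ≡ U + 2 * (U * r) [MOD 2 * r + 1] :=
      ((Nat.mod_modEq _ _).mul_left 2).add_left U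
    refine (Nat.modEq_zero_iff_dvd.1 (h1.trans ?_))
    exact Nat.modEq_zero_iff_dvd.2 ⟨U, by ring⟩
  refine ⟨x, ?_, L - j, by omega, ?_⟩
  · by_contra! h
    have h1 := Nat.mul_le_mul_left (2 * r + 1) h
    have h2 : 2 * (2 * L + U) + 2 ≤ (2 * L + 1) * (2 * r + 1 + 1) := by
      have : 2 ≤ (2 * L + 1) * (2 * r + 1 + 1) := by nlinarith
      omega
    nlinarith
  · omega

theorem isSPerfect_two_pow_mul_prime {m : ℤ} {M k p : ℕ} (hm : (M : ℤ) = m + 1) (hM : 2 ≤ M)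
    (hp : p.Prime) (hMp : M < p) (hk : 2 * p ≤ 2 ^ k)
    (h : ((2 * 2 ^ k - 1) * (p + 1) : ZMod M) = 2) :
    IsSPerfect {-1, m} ((2 ^ k * p : ℕ) : ℤ) := by
  have hge : 2 ≤ (2 * 2 ^ k - 1) * (p + 1) :=
    (show 2 ≤ 1 * (p + 1) by omega).trans (Nat.mul_le_mul_right _ (by omega))
  have hcast : (((2 * 2 ^ k - 1) * (p + 1) : ℕ) : ZMod M) = (2 : ℕ) := by
    rw [Nat.cast_mul, Nat.cast_sub (by omega)]
    push_cast
    exact h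
  obtain ⟨T, hT⟩ := (Nat.modEq_iff_dvd' hge).1 ((ZMod.natCast_eq_natCast_iff _ _ _).1 hcast).symm
  have hT' : (2 * 2 ^ k - 1) * (p + 1) = 2 + M * T := by omega
  obtain ⟨x, hx, y, hy, hxy⟩ := exists_eq_mul_add_two_mul hM
    (hp.eq_two_or_odd.resolve_left (by omega)) hMp hk hT'
  obtain ⟨A, hA, hsum⟩ := exists_sum_divisors_two_pow_mul_prime hp (by omega) hx hy
  refine isSPerfect_of_sum_divisors (by nlinarith) hA ?_
  rw [hsum, ← hxy, sum_divisors_two_pow_mul_prime hp (by omega), pow_succ', hT', ← hm]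
  push_cast
  ring

theorem exists_pow_idempotent {R : Type*} [Monoid R] [Finite R] (a : R) :
    ∃ k, 0 < k ∧ a ^ k * a ^ k = a ^ k := by
  obtain ⟨i, d, hd, h⟩ : ∃ i d, 0 < d ∧ a ^ (i + d) = a ^ i := by
    obtain ⟨i, j, hij, h⟩ := Finite.exists_ne_map_eq_of_infinite (fun n : ℕ => a ^ n)
    rcases hij.lt_or_gt with hlt | hlt
    · exact ⟨i, j - i, by omega, by rw [Nat.add_sub_cancel' hlt.le]; exact h.symm⟩
    · exact ⟨j, i - j, by omega, by rw [Nat.add_sub_cancel' hlt.le]; exact h⟩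
  have hper : ∀ s t, a ^ (i + t + d * s) = a ^ (i + t) := by
    intro s t
    induction s with
    | zero => simp
    | succ s ih =>
      rw [show i + t + d * (s + 1) = i + d + (t + d * s) by ring, pow_add, h, ← pow_add,
        ← add_assoc, ih]
  refine ⟨d * (i + 1), by positivity, ?_⟩
  obtain ⟨t, ht⟩ : ∃ t, d * (i + 1) = i + t := Nat.exists_eq_add_of_le (by nlinarith)
  have := hper (i + 1) t
  rwa [← ht, pow_add] at this

theorem isUnit_four_mul_two_pow_sub_three {M k : ℕ}
    (h : (2 : ZMod M) ^ k * 2 ^ k = 2 ^ k) : IsUnit (4 * 2 ^ k - 3 : ZMod M) := by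
  have hdvd : (M : ℤ) ∣ 2 ^ k * (2 ^ k - 1) := by
    rw [← ZMod.intCast_zmod_eq_zero_iff_dvd]
    push_cast
    linear_combination h
  have h2 : IsCoprime (4 * 2 ^ k - 3 : ℤ) 2 := ⟨-1, 2 * 2 ^ k - 1, by ring⟩
  have h3 : IsCoprime (4 * 2 ^ k - 3 : ℤ) (2 ^ k - 1) := ⟨1, -4, by ring⟩
  have h4 := (h2.pow_right (n := k)).mul_right h3 |>.of_isCoprime_of_dvd_right hdvd
  have := (ZMod.coe_int_isUnit_iff_isCoprime (4 * 2 ^ k - 3) M).2 h4.symm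
  push_cast at this
  exact this

theorem stmt12 (m : ℤ) (hm : 1 ≤ m) :
    {n : ℤ | 0 < n ∧ IsSPerfect {-1, m} n}.Infinite := by
  obtain ⟨M, hM⟩ := Int.eq_ofNat_of_zero_le (show 0 ≤ m + 1 by omega)
  have hM2 : 2 ≤ M := by omega
  have : NeZero M := ⟨by omega⟩
  obtain ⟨k, hk, he⟩ := exists_pow_idempotent (2 : ZMod M)
  obtain ⟨p, hMp, hp, hpe⟩ := Nat.forall_exists_prime_gt_and_eq_mod
    (isUnit_four_mul_two_pow_sub_three he) M
  have hpow (t : ℕ) : (2 : ZMod M) ^ (k * (t + 1)) = 2 ^ k := by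
    rw [pow_mul]
    exact IsIdempotentElem.pow_succ_eq t he
  refine Set.infinite_of_injective_forall_mem
    (f := fun t : ℕ => ((2 ^ (k * (2 * p + t + 1)) * p : ℕ) : ℤ)) ?_ ?_
  · intro s t hst
    have h1 := Nat.eq_of_mul_eq_mul_right hp.pos (Int.natCast_inj.1 hst)
    have h2 := Nat.eq_of_mul_eq_mul_left hk (Nat.pow_right_injective le_rfl h1)
    omega
  · intro t
    refine ⟨by have := hp.pos; positivity,
      isSPerfect_two_pow_mul_prime hM.symm hM2 hp hMp ?_ ?_⟩
    · have : 2 * p ≤ k * (2 * p + t + 1) := by nlinarith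
      exact this.trans Nat.lt_two_pow_self.le
    · rw [hpow, hpe]
      linear_combination 8 * he
end

section
/- For every odd prime p there exists an integer k ≥ 1 such that 2^k·p is {−1, 1}-perfect. -/
/-- Every integer of absolute value less than `2 ^ k` and of the same parity as `2 ^ k - 1` is a
signed sum of `1, 2, …, 2 ^ (k - 1)`. -/
theorem exists_signs_sum_two_pow (k : ℕ) (t : ℤ) (h0 : 0 ≤ t) (ht : t < 2 ^ k) :
    ∃ s : ℕ → ℤ, (∀ i, s i = -1 ∨ s i = 1) ∧
      ∑ i ∈ Finset.range k, s i * 2 ^ i = 2 * t + 1 - 2 ^ k := by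
  induction k generalizing t with
  | zero =>
    refine ⟨fun _ => 1, fun _ => Or.inr rfl, ?_⟩
    simp at ht ⊢
    omega
  | succ k ih =>
    have extend (ε u : ℤ) (hε : ε = -1 ∨ ε = 1) (hu0 : 0 ≤ u) (hu : u < 2 ^ k)
        (htu : 2 * u + 1 - 2 ^ k + ε * 2 ^ k = 2 * t + 1 - 2 ^ (k + 1)) :
        ∃ s : ℕ → ℤ, (∀ i, s i = -1 ∨ s i = 1) ∧
          ∑ i ∈ Finset.range (k + 1), s i * 2 ^ i = 2 * t + 1 - 2 ^ (k + 1) := by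
      obtain ⟨s, hs, hsum⟩ := ih u hu0 hu
      refine ⟨Function.update s k ε, fun i => ?_, ?_⟩
      · by_cases hi : i = k
        · simpa [hi] using hε
        · simpa [hi] using hs i
      · rw [Finset.sum_range_succ, Function.update_self, ← htu, ← hsum]
        congr 1
        refine Finset.sum_congr rfl fun i hi => ?_
        rw [Function.update_of_ne (Finset.mem_range.mp hi).ne]
    rw [pow_succ] at ht
    by_cases h : t < 2 ^ k
    · exact extend (-1) t (Or.inl rfl) h0 h (by ring)
    · exact extend 1 (t - 2 ^ k) (Or.inr rfl) (by omega) (by omega) (by ring)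

theorem midDivisors_two_pow_mul_prime (k p : ℕ) (hp : p.Prime) :
    midDivisors ((2 : ℤ) ^ k * p) =
      (Finset.range k).image (fun i => 2 ^ (i + 1)) ∪
        (Finset.range k).image (fun i => 2 ^ i * p) := by
  have habs : ((2 : ℤ) ^ k * p).natAbs = 2 ^ k * p := by simp [Int.natAbs_mul, Int.natAbs_pow]
  have hp1 := hp.one_lt
  ext d
  simp only [midDivisors, habs, Finset.mem_filter, Nat.mem_divisors, Finset.mem_union,
    Finset.mem_image, Finset.mem_range]
  constructor
  · rintro ⟨⟨hd, -⟩, hd1, hdn⟩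
    obtain ⟨a, b, ha, hb, rfl⟩ := exists_dvd_and_dvd_of_dvd_mul hd
    obtain ⟨i, hi, rfl⟩ := (Nat.dvd_prime_pow Nat.prime_two).mp ha
    rcases (Nat.dvd_prime hp).mp hb with rfl | rfl
    · left
      obtain _ | i := i
      · simp at hd1
      · exact ⟨i, hi, by simp⟩
    · right
      refine ⟨i, lt_of_le_of_ne hi ?_, rfl⟩
      rintro rfl
      exact lt_irrefl _ hdn
  · have hne : 2 ^ k * p ≠ 0 := by positivity
    rintro (⟨i, hi, rfl⟩ | ⟨i, hi, rfl⟩)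
    · have hle : 2 ^ (i + 1) ≤ 2 ^ k := Nat.pow_le_pow_right two_pos hi
      refine ⟨⟨(pow_dvd_pow 2 hi).mul_right p, hne⟩, Nat.one_lt_two_pow (by omega), ?_⟩
      have hpos : 0 < 2 ^ k := by positivity
      nlinarith
    · refine ⟨⟨Nat.mul_dvd_mul_right (pow_dvd_pow 2 hi.le) p, hne⟩, ?_, ?_⟩
      · have hpos : 0 < 2 ^ i := by positivity
        nlinarith
      · exact Nat.mul_lt_mul_of_pos_right (Nat.pow_lt_pow_right one_lt_two hi) hp.pos

theorem not_dvd_two_pow_of_odd_prime {p : ℕ} (hp : p.Prime) (hodd : Odd p) (i : ℕ) :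
    ¬ p ∣ 2 ^ i := fun h => by
  rw [(Nat.prime_dvd_prime_iff_eq hp Nat.prime_two).mp (hp.dvd_of_dvd_pow h)] at hodd
  exact absurd hodd (by decide)

theorem isSPerfect_two_pow_mul_prime_s18 {k p : ℕ} (hp : p.Prime) (hodd : Odd p) {f g : ℕ → ℤ}
    (hf : ∀ i, f i = -1 ∨ f i = 1) (hg : ∀ i, g i = -1 ∨ g i = 1)
    (h : (2 : ℤ) ^ k * p = 1 + (2 * ∑ i ∈ Finset.range k, f i * 2 ^ i +
      p * ∑ i ∈ Finset.range k, g i * 2 ^ i)) :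
    IsSPerfect {-1, 1} ((2 : ℤ) ^ k * p) := by
  have hpow := not_dvd_two_pow_of_odd_prime hp hodd
  refine ⟨?_, fun d => if p ∣ d then g (Nat.log 2 (d / p)) else f (Nat.log 2 d - 1),
    fun d _ => ?_, ?_⟩
  · have hpos : 0 < 2 ^ k := by positivity
    have hp1 := hp.one_lt
    simp only [Int.natAbs_mul, Int.natAbs_pow, Int.natAbs_natCast, Int.reduceAbs]
    nlinarith
  · simp only [Set.mem_insert_iff, Set.mem_singleton_iff]
    split_ifs
    exacts [hg _, hf _]
  · rw [midDivisors_two_pow_mul_prime k p hp, Finset.sum_union, Finset.sum_image,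
      Finset.sum_image, h, Finset.mul_sum, Finset.mul_sum]
    · congr 2
      · refine Finset.sum_congr rfl fun i _ => ?_
        beta_reduce
        rw [if_neg (hpow _), Nat.log_pow one_lt_two, Nat.add_sub_cancel]
        push_cast
        ring
      · refine Finset.sum_congr rfl fun i _ => ?_
        beta_reduce
        rw [if_pos (Nat.dvd_mul_left p _), Nat.mul_div_cancel _ hp.pos, Nat.log_pow one_lt_two]
        push_cast
        ring
    · intro i _ j _ hij
      exact Nat.pow_right_injective le_rfl (Nat.eq_of_mul_eq_mul_right hp.pos hij)
    · intro i _ j _ hij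
      exact Nat.succ_injective (Nat.pow_right_injective le_rfl hij)
    · rw [Finset.disjoint_left]
      intro d hd hd'
      obtain ⟨i, -, rfl⟩ := Finset.mem_image.mp hd
      obtain ⟨j, -, hj⟩ := Finset.mem_image.mp hd'
      exact hpow (i + 1) (hj ▸ Nat.dvd_mul_left p _)

theorem stmt18 (p : ℕ) (hp : p.Prime) (hodd : Odd p) :
    ∃ k : ℕ, 1 ≤ k ∧ IsSPerfect {-1, 1} ((2 : ℤ) ^ k * p) := by
  refine ⟨p + 1, by omega, ?_⟩
  have hlt : (p : ℤ) < 2 ^ p := by exact_mod_cast Nat.lt_two_pow_self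
  have hp2 := hp.two_le
  obtain ⟨c, a, hc, ha, hpc⟩ : ∃ c a : ℤ, (c = 0 ∨ c = 1) ∧ (0 ≤ a ∧ a < p) ∧
      p * (2 * c + 1) = 4 * a + 3 := by
    obtain ⟨m, rfl⟩ := hodd
    obtain ⟨q, rfl | rfl⟩ := m.even_or_odd'
    · exact ⟨1, 3 * q, Or.inr rfl, by omega, by push_cast; ring⟩
    · exact ⟨0, q, Or.inl rfl, by omega, by push_cast; ring⟩
  have hN : (2 : ℤ) ^ (p + 1) = 2 * 2 ^ p := by ring
  obtain ⟨f, hf, hfsum⟩ := exists_signs_sum_two_pow (p + 1) (a + 2 ^ p) (by omega) (by omega)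
  obtain ⟨g, hg, hgsum⟩ :=
    exists_signs_sum_two_pow (p + 1) (2 ^ (p + 1) - 1 - c) (by omega) (by omega)
  refine isSPerfect_two_pow_mul_prime_s18 hp hodd hf hg ?_
  rw [hfsum, hgsum, hN]
  linear_combination hpc
end
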